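/- For every real $p>1$ there exists a constant $C>0$, depending only on $p$, such that for all $w_-<w_m$ (with $\delta_R=w_m-w_-$ and $w_0$ the tanh profile) and all $t>0$, $\int_{\mathbb{R}} w_0'(y)^p\,(1+t\,w_0'(y))^{1-4p}\,dy\le C\,\delta_R\,t^{1-p}$. -/

import Mathlib

open MeasureTheory

/-- The tanh profile `w₀(x) = (w_m + w_-)/2 + (w_m - w_-)/2 * tanh x`. -/
noncomputable def tanhProfile (wminus wm : ℝ) (x : ℝ) : ℝ :=
  (wm + wminus) / 2 + (wm - wminus) / 2 * Real.tanh x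

open Filter in
/-- A nonnegative derivative of a function with values in `[m, M]` is integrable on the line,
with integral at most `M - m`. -/
theorem integrable_and_integral_le_of_hasDerivAt_of_nonneg {g g' : ℝ → ℝ} {m M : ℝ}
    (hderiv : ∀ x, HasDerivAt g (g' x) x) (hnonneg : ∀ x, 0 ≤ g' x)
    (hm : ∀ x, m ≤ g x) (hM : ∀ x, g x ≤ M) :
    Integrable g' ∧ ∫ x, g' x ≤ M - m := by
  have hcont : Continuous g := continuous_iff_continuousAt.2 fun x => (hderiv x).continuousAt
  have hIoc (a b : ℝ) : IntegrableOn g' (Set.Ioc a b) :=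
    intervalIntegral.integrableOn_deriv_of_nonneg hcont.continuousOn
      (fun x _ => hderiv x) (fun x _ => hnonneg x)
  have hle (n : ℕ) : ∫ x in (-(n : ℝ))..n, g' x ≤ M - m := by
    have hn : -(n : ℝ) ≤ n := by linarith [n.cast_nonneg (α := ℝ)]
    rw [intervalIntegral.integral_eq_sub_of_hasDerivAt (fun x _ => hderiv x)
      ((intervalIntegrable_iff_integrableOn_Ioc_of_le hn).2 (hIoc _ _))]
    linarith [hM n, hm (-n)]
  have hbot : Tendsto (fun n : ℕ => -(n : ℝ)) atTop atBot :=
    tendsto_neg_atTop_atBot.comp tendsto_natCast_atTop_atTop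
  have htop : Tendsto (fun n : ℕ => (n : ℝ)) atTop atTop := tendsto_natCast_atTop_atTop
  have hg_int : Integrable g' :=
    integrable_of_intervalIntegral_norm_bounded (M - m) (fun n : ℕ => hIoc (-(n : ℝ)) n) hbot htop
      (Eventually.of_forall fun n => by
        simpa only [Real.norm_of_nonneg (hnonneg _)] using hle n)
  exact ⟨hg_int, le_of_tendsto' (intervalIntegral_tendsto_integral hg_int hbot htop) hle⟩

theorem Real.hasDerivAt_tanh (x : ℝ) : HasDerivAt Real.tanh (1 - Real.tanh x ^ 2) x := by
  have hc := (Real.cosh_pos x).ne'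
  have h := (Real.hasDerivAt_sinh x).div (Real.hasDerivAt_cosh x) hc
  rw [show Real.tanh = Real.sinh / Real.cosh from funext Real.tanh_eq_sinh_div_cosh]
  refine h.congr_deriv ?_
  simp only [Pi.div_apply]
  field_simp

theorem hasDerivAt_tanhProfile (wminus wm x : ℝ) :
    HasDerivAt (tanhProfile wminus wm) ((wm - wminus) / 2 * (1 - Real.tanh x ^ 2)) x :=
  ((Real.hasDerivAt_tanh x).const_mul _).const_add _

theorem rpow_mul_one_add_mul_rpow_le {p q t a : ℝ} (hp : 1 ≤ p) (hq : q ≤ 1 - p) (ht : 0 < t)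
    (ha : 0 < a) : a ^ p * (1 + t * a) ^ q ≤ t ^ (1 - p) * a := by
  have hta : 0 < t * a := mul_pos ht ha
  calc a ^ p * (1 + t * a) ^ q ≤ a ^ p * (t * a) ^ (1 - p) := by
        gcongr
        exact (Real.rpow_le_rpow_of_exponent_le (by linarith) hq).trans
          (Real.rpow_le_rpow_of_nonpos hta (by linarith) (by linarith))
    _ = t ^ (1 - p) * a := by
        rw [Real.mul_rpow ht.le ha.le, mul_left_comm, ← Real.rpow_add ha, add_sub_cancel,
          Real.rpow_one]

/-- For every real `p > 1` there is `C > 0`, depending only on `p`, so that for all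
`w_- < w_m` and all `t > 0`,
`∫ w₀'(y)^p (1 + t w₀'(y))^(1-4p) dy ≤ C δ_R t^(1-p)`. -/
theorem stmt_3 (p : ℝ) (hp : 1 < p) :
    ∃ C > 0, ∀ wminus wm : ℝ, wminus < wm → ∀ t : ℝ, 0 < t →
      ∫ y : ℝ, (deriv (tanhProfile wminus wm) y) ^ p
          * (1 + t * deriv (tanhProfile wminus wm) y) ^ (1 - 4 * p)
        ≤ C * (wm - wminus) * t ^ (1 - p) := by
  refine ⟨1, one_pos, fun wminus wm hw t ht => ?_⟩
  have hpos (y : ℝ) : 0 < deriv (tanhProfile wminus wm) y := by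
    rw [(hasDerivAt_tanhProfile wminus wm y).deriv]
    exact mul_pos (by linarith) (by linarith [Real.tanh_sq_lt_one y])
  obtain ⟨hg_int, hle⟩ := integrable_and_integral_le_of_hasDerivAt_of_nonneg
    (fun y => (hasDerivAt_tanhProfile wminus wm y).differentiableAt.hasDerivAt)
    (fun y => (hpos y).le) (m := wminus) (M := wm)
    (fun y => by unfold tanhProfile; nlinarith [Real.neg_one_lt_tanh y])
    (fun y => by unfold tanhProfile; nlinarith [Real.tanh_lt_one y])
  calc _ ≤ ∫ y : ℝ, t ^ (1 - p) * deriv (tanhProfile wminus wm) y := by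
        refine integral_mono_of_nonneg (Filter.Eventually.of_forall fun y => ?_) (hg_int.const_mul _)
          (Filter.Eventually.of_forall fun y =>
            rpow_mul_one_add_mul_rpow_le hp.le (by linarith) ht (hpos y))
        have := hpos y
        simp only [Pi.zero_apply]
        positivity
    _ ≤ 1 * (wm - wminus) * t ^ (1 - p) := by
        rw [integral_const_mul, one_mul, mul_comm]
        gcongr
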